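/- Suppose p does not divide n. Let h, k ∈ F_q[x] with k(c) ∈ F_q \ {0} for every c ∈ F_q and gcd(h(x), (x^n − 1)/(x − 1)) = 1 in F_q[x], let f ∈ F_{q^n}[x], and suppose P(x) = f(Tr_{q^n/q}(x)) + k(Tr_{q^n/q}(x))·L_h(x) is a permutation polynomial of F_{q^n}, so that Q(x) = T_n[f](x) + k(x)·h(1)·x is a permutation polynomial of F_q; let R ∈ F_q[x] be an inverse of Q on F_q (i.e., R(Q(c)) = c for all c ∈ F_q). Let H ∈ F_q[x] be the unique polynomial of degree at most n − 2 with h(x)·H(x) ≡ 1 (mod (x^n − 1)/(x − 1)), set M(x) = −k(x)^{q−2}·L_H(f(x)) + x·(1 − h(1)·H(1))/n, and let F ∈ F_{q^n}[x] be any polynomial satisfying F(x) ≡ M(R(x)) (mod x^q − x). Then P_0(x) = F(Tr_{q^n/q}(x)) + k(R(Tr_{q^n/q}(x)))^{q−2}·L_H(x) satisfies P_0(P(a)) = a for every a ∈ F_{q^n}; that is, P_0 is the compositional inverse permutation of P on F_{q^n}. -/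

import Mathlib

open Polynomial

/-- The linearized `q`-associate of `f ∈ 𝔽_q[x]`, evaluated on an extension field:
`L_f(y) = Σ aᵢ y^(qⁱ)` where `q` is the cardinality of `Fq`. -/
noncomputable def Lq {Fq Fqn : Type*} [Field Fq] [Fintype Fq] [Field Fqn] [Algebra Fq Fqn]
    (f : Polynomial Fq) (y : Fqn) : Fqn :=
  f.sum fun i a => algebraMap Fq Fqn a * y ^ (Fintype.card Fq) ^ i

/-- `T_n[f](x) = Σ Tr(aᵢ) xⁱ ∈ 𝔽_q[x]` for `f = Σ aᵢ xⁱ ∈ 𝔽_{qⁿ}[x]`, where `Tr` is the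
field trace from `𝔽_{qⁿ}` onto `𝔽_q`. -/
noncomputable def Tn (Fq : Type*) {Fqn : Type*} [Field Fq] [Field Fqn] [Algebra Fq Fqn]
    (f : Polynomial Fqn) : Polynomial Fq :=
  f.sum fun i a => C (Algebra.trace Fq Fqn a) * X ^ i

/-- The linearized `q`-associate of `f ∈ 𝔽_q[x]` as a polynomial over the extension `𝔽_{qⁿ}`. -/
noncomputable def LqPolyExt {Fq : Type*} (Fqn : Type*) [Field Fq] [Fintype Fq] [Field Fqn]
    [Algebra Fq Fqn] (f : Polynomial Fq) : Polynomial Fqn :=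
  f.sum fun i a => C (algebraMap Fq Fqn a) * X ^ (Fintype.card Fq) ^ i

section LinearizedAssociate

variable {Fq Fqn : Type*} [Field Fq] [Fintype Fq] [Field Fqn] [Algebra Fq Fqn]

lemma Lq_eq_aeval_frobenius (f : Fq[X]) (y : Fqn) :
    Lq f y = aeval (FiniteField.frobeniusAlgHom Fq Fqn).toLinearMap f y := by
  have hpow (i : ℕ) :
      ((FiniteField.frobeniusAlgHom Fq Fqn).toLinearMap ^ i) y = y ^ Fintype.card Fq ^ i := by
    induction i with
    | zero => simp
    | succ i ih =>
      rw [pow_succ', Module.End.mul_apply, ih, pow_succ, pow_mul]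
      rfl
  rw [aeval_eq_sum_range, Lq, sum_over_range _ (by simp)]
  simp [hpow, Algebra.smul_def]

lemma Lq_algebraMap (f : Fq[X]) (c : Fq) :
    Lq f (algebraMap Fq Fqn c) = algebraMap Fq Fqn (f.eval 1 * c) := by
  simp [Lq, eval_eq_sum, Polynomial.sum, ← map_pow, FiniteField.pow_card_pow, Finset.sum_mul]

lemma eval_LqPolyExt (f : Fq[X]) (y : Fqn) : (LqPolyExt Fqn f).eval y = Lq f y := by
  simp [LqPolyExt, Lq, Polynomial.sum, eval_finsetSum]

variable [FiniteDimensional Fq Fqn]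

lemma trace_pow_card_pow (y : Fqn) (i : ℕ) :
    Algebra.trace Fq Fqn (y ^ Fintype.card Fq ^ i) = Algebra.trace Fq Fqn y := by
  have : Finite Fqn := Module.finite_of_finite Fq
  induction i with
  | zero => simp
  | succ i ih =>
    rw [pow_succ, pow_mul, ← ih]
    exact Algebra.trace_eq_of_algEquiv (FiniteField.frobeniusAlgEquivOfAlgebraic Fq Fqn) _

lemma trace_Lq (f : Fq[X]) (y : Fqn) :
    Algebra.trace Fq Fqn (Lq f y) = f.eval 1 * Algebra.trace Fq Fqn y := by
  simp [Lq, Polynomial.sum, eval_eq_sum, ← Algebra.smul_def, trace_pow_card_pow, Finset.sum_mul]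

/-- `(xⁿ - 1)/(x - 1)` is the conventional associate of the trace. -/
lemma Lq_geom_sum (y : Fqn) :
    Lq (∑ i ∈ Finset.range (Module.finrank Fq Fqn), X ^ i : Fq[X]) y =
      algebraMap Fq Fqn (Algebra.trace Fq Fqn y) := by
  have : Finite Fqn := Module.finite_of_finite Fq
  rw [FiniteField.algebraMap_trace_eq_sum_pow, Lq_eq_aeval_frobenius, map_sum,
    LinearMap.sum_apply]
  refine Finset.sum_congr rfl fun i _ => ?_
  rw [← Lq_eq_aeval_frobenius, Lq, X_pow_eq_monomial, sum_monomial_index _ _ (by simp), map_one,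
    one_mul, Nat.card_eq_fintype_card]

end LinearizedAssociate

lemma eval_Tn {Fq Fqn : Type*} [Field Fq] [Field Fqn] [Algebra Fq Fqn] (f : Fqn[X]) (c : Fq) :
    (Tn Fq f).eval c = Algebra.trace Fq Fqn (f.eval (algebraMap Fq Fqn c)) := by
  rw [Tn, Polynomial.sum, eval_finsetSum, eval_eq_sum, Polynomial.sum, map_sum]
  refine Finset.sum_congr rfl fun i _ => ?_
  rw [mul_comm (f.coeff i), ← map_pow, ← Algebra.smul_def, map_smul, smul_eq_mul]
  simp only [eval_mul, eval_C, eval_pow, eval_X, mul_comm]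

lemma X_pow_sub_one_div_X_sub_one {K : Type*} [Field K] (n : ℕ) :
    ((X ^ n - 1) / (X - 1) : K[X]) = ∑ i ∈ Finset.range n, X ^ i := by
  rw [← geom_sum_mul]
  exact mul_div_cancel_right₀ _ (X_sub_C_ne_zero (1 : K))

/-- **Compositional inverse, case `p ∤ n`.** Suppose `p ∤ n`, `h, k ∈ 𝔽_q[x]` with
`k(c) ≠ 0` for all `c ∈ 𝔽_q` and `gcd(h, (xⁿ-1)/(x-1)) = 1`, and
`P(x) = f(Tr(x)) + k(Tr(x))·L_h(x)` is a PP of `𝔽_{qⁿ}`. Let `R` invert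
`Q(x) = T_n[f](x) + k(x)·h(1)·x` on `𝔽_q`, let `H` have degree `≤ n-2` with
`h·H ≡ 1 (mod (xⁿ-1)/(x-1))`, set
`M(x) = -k(x)^{q-2}·L_H(f(x)) + x·(1 - h(1)·H(1))/n`, and let
`F ≡ M(R(x)) (mod x^q - x)`. Then `P₀(x) = F(Tr(x)) + k(R(Tr(x)))^{q-2}·L_H(x)`
satisfies `P₀(P(a)) = a` for all `a ∈ 𝔽_{qⁿ}`. -/
theorem trace_inverse_PP_of_not_char_dvd {Fq Fqn : Type*} [Field Fq] [Fintype Fq]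
    [DecidableEq Fq] [Field Fqn] [Algebra Fq Fqn]
    {n : ℕ} (hn : 0 < n) (hrank : Module.finrank Fq Fqn = n)
    (hpn : ¬ ringChar Fq ∣ n)
    (h k : Polynomial Fq) (hk : ∀ c : Fq, k.eval c ≠ 0)
    (hgcd : gcd h ((X ^ n - 1) / (X - 1) : Polynomial Fq) = 1)
    (f : Polynomial Fqn)
    (P : Fqn → Fqn)
    (hP : P = fun x : Fqn =>
      f.eval (algebraMap Fq Fqn (Algebra.trace Fq Fqn x)) +
        algebraMap Fq Fqn (k.eval (Algebra.trace Fq Fqn x)) * Lq h x)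
    (hPbij : Function.Bijective P)
    (R : Polynomial Fq)
    (hR : ∀ c : Fq, R.eval ((Tn Fq f + k * C (h.eval 1) * X : Polynomial Fq).eval c) = c)
    (H : Polynomial Fq) (hHdeg : H.natDegree ≤ n - 2)
    (hH : ((X ^ n - 1) / (X - 1) : Polynomial Fq) ∣ h * H - 1)
    (M : Polynomial Fqn)
    (hM : M = -((k.map (algebraMap Fq Fqn)) ^ (Fintype.card Fq - 2)) *
        (LqPolyExt Fqn H).comp f +
      C (algebraMap Fq Fqn ((1 - h.eval 1 * H.eval 1) / (n : Fq))) * X)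
    (F : Polynomial Fqn)
    (hF : (X ^ Fintype.card Fq - X : Polynomial Fqn) ∣
      F - M.comp (R.map (algebraMap Fq Fqn))) :
    ∀ a : Fqn,
      F.eval (algebraMap Fq Fqn (Algebra.trace Fq Fqn (P a))) +
        algebraMap Fq Fqn (k.eval (R.eval (Algebra.trace Fq Fqn (P a)))) ^
            (Fintype.card Fq - 2) * Lq H (P a) = a := by
  subst hP hrank hM
  intro a
  have : FiniteDimensional Fq Fqn := Module.finite_of_finrank_pos hn
  have hn0 : (Module.finrank Fq Fqn : Fq) ≠ 0 := fun h0 => hpn ((ringChar.spec Fq _).1 h0)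
  set c := Algebra.trace Fq Fqn a with hc
  have htrace : Algebra.trace Fq Fqn (f.eval (algebraMap Fq Fqn c) +
      algebraMap Fq Fqn (k.eval c) * Lq h a) =
      (Tn Fq f + k * C (h.eval 1) * X : Fq[X]).eval c := by
    rw [map_add, ← Algebra.smul_def, map_smul, trace_Lq, ← eval_Tn, ← hc]
    simp [mul_assoc]
  have hFeval (b : Fq) : F.eval (algebraMap Fq Fqn b) =
      -algebraMap Fq Fqn (k.eval (R.eval b)) ^ (Fintype.card Fq - 2) *
          Lq H (f.eval (algebraMap Fq Fqn (R.eval b))) +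
        algebraMap Fq Fqn ((1 - h.eval 1 * H.eval 1) / (Module.finrank Fq Fqn : Fq)) *
          algebraMap Fq Fqn (R.eval b) := by
    obtain ⟨g, hg⟩ := hF
    have hb := congrArg (eval (algebraMap Fq Fqn b)) hg
    have hzero : algebraMap Fq Fqn b ^ Fintype.card Fq - algebraMap Fq Fqn b = 0 := by
      rw [← map_pow, FiniteField.pow_card, sub_self]
    rw [eval_sub, eval_mul, eval_sub, eval_pow, eval_X, hzero, zero_mul, sub_eq_zero] at hb
    rw [hb]
    simp only [eval_comp, eval_add, eval_mul, eval_neg, eval_pow, eval_C, eval_X,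
      eval_map_algebraMap, aeval_algebraMap_apply_eq_algebraMap_eval, eval_LqPolyExt]
  have hkinv : algebraMap Fq Fqn (k.eval c) ^ (Fintype.card Fq - 2) *
      algebraMap Fq Fqn (k.eval c) = 1 := by
    have hcard := Fintype.one_lt_card (α := Fq)
    rw [← pow_succ, ← map_pow, show Fintype.card Fq - 2 + 1 = Fintype.card Fq - 1 by omega,
      FiniteField.pow_card_sub_one_eq_one _ (hk c), map_one]
  have hLadd : Lq H (f.eval (algebraMap Fq Fqn c) + algebraMap Fq Fqn (k.eval c) * Lq h a) =
      Lq H (f.eval (algebraMap Fq Fqn c)) + algebraMap Fq Fqn (k.eval c) * Lq (h * H) a := by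
    simp only [Lq_eq_aeval_frobenius, ← Algebra.smul_def, map_add, map_smul, mul_comm h H,
      map_mul, Module.End.mul_apply]
  rw [X_pow_sub_one_div_X_sub_one] at hH
  obtain ⟨s, hs⟩ := hH
  have hcomp : Lq (h * H) a = a + algebraMap Fq Fqn (s.eval 1 * c) := by
    rw [← Lq_algebraMap, hc, ← Lq_geom_sum, sub_eq_iff_eq_add'.1 hs, mul_comm _ s]
    simp only [Lq_eq_aeval_frobenius, map_add, map_mul, map_one, Module.End.mul_apply,
      LinearMap.add_apply, Module.End.one_apply]
  have hone : (1 - h.eval 1 * H.eval 1) / (Module.finrank Fq Fqn : Fq) = -s.eval 1 := by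
    have := congrArg (eval 1) hs
    simp [eval_finsetSum] at this
    rw [div_eq_iff hn0]
    linear_combination -this
  simp only [← hc]
  rw [htrace, hFeval, hR, hLadd, hcomp, hone, map_neg, map_mul]
  linear_combination (a + algebraMap Fq Fqn (s.eval 1) * algebraMap Fq Fqn c) * hkinv
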